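/- Let α > -1/2 and β > -1 be real numbers. Then for every f ∈ L_{(α,β)}, lim_{k→∞} ∫_0^{π/2} f(θ) R_k^{(α,β)}(cos θ) (sin(θ/2))^{2α+1} (cos(θ/2))^{2β+1} dθ = 0. -/

import Mathlib

open MeasureTheory Filter Set

noncomputable section

/-- Generalized binomial coefficient `C(a, m) = Γ(a+1)/(Γ(m+1)Γ(a-m+1))`. -/
def genBinom (a : ℝ) (m : ℕ) : ℝ :=
  Real.Gamma (a + 1) / (Real.Gamma ((m : ℝ) + 1) * Real.Gamma (a - (m : ℝ) + 1))

/-- The Jacobi polynomial `P_k^{(α,β)}(x)`. -/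
def jacobiP (α β : ℝ) (k : ℕ) (x : ℝ) : ℝ :=
  ∑ s ∈ Finset.range (k + 1),
    genBinom ((k : ℝ) + α) (k - s) * genBinom ((k : ℝ) + β) s *
      ((x - 1) / 2) ^ s * ((x + 1) / 2) ^ (k - s)

/-- The normalized Jacobi polynomial `R_k^{(α,β)}(x) = P_k^{(α,β)}(x)/P_k^{(α,β)}(1)`. -/
def jacobiR (α β : ℝ) (k : ℕ) (x : ℝ) : ℝ := jacobiP α β k x / jacobiP α β k 1

/-- The Jacobi weight `(sin(θ/2))^{2α+1} (cos(θ/2))^{2β+1}`. -/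
def jacobiWeight (α β : ℝ) (θ : ℝ) : ℝ :=
  Real.sin (θ / 2) ^ (2 * α + 1) * Real.cos (θ / 2) ^ (2 * β + 1)

/-- `f ∈ L_{(α,β)}`: `f` is integrable on `[0,π]` against the Jacobi weight. -/
def MemJacobiL (α β : ℝ) (f : ℝ → ℝ) : Prop :=
  IntegrableOn (fun θ => f θ * jacobiWeight α β θ) (Ioc 0 Real.pi)

/-- The norm `‖f‖_{L_{(α,β)}}`. -/
def jacobiNorm (α β : ℝ) (f : ℝ → ℝ) : ℝ :=
  ∫ θ in Ioc (0 : ℝ) Real.pi, |f θ| * jacobiWeight α β θ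

/-- The `k`-th Fourier–Jacobi coefficient `f̂_{(α,β)}(k)`. -/
def fourierJacobi (α β : ℝ) (f : ℝ → ℝ) (k : ℕ) : ℝ :=
  ∫ θ in Ioc (0 : ℝ) Real.pi, f θ * jacobiR α β k (Real.cos θ) * jacobiWeight α β θ

end

open Topology

/-- A solution `y` on `ℝ` with derivatives `y₁`, `y₂` of the Jacobi differential equation on
`(0, 1)` with eigenvalue `l`, normalized by `y 1 = 1`. -/
structure IsJacobiSolution (α β l : ℝ) (y y₁ y₂ : ℝ → ℝ) : Prop where
  hasDerivAt : ∀ x, HasDerivAt y (y₁ x) x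
  hasDerivAt_deriv : ∀ x, HasDerivAt y₁ (y₂ x) x
  ode : ∀ x, 0 ≤ x → x < 1 →
    (1 - x ^ 2) * y₂ x + (β - α - (α + β + 2) * x) * y₁ x + l * y x = 0
  map_one : y 1 = 1

/-- The Sonine energy of a solution of the Jacobi equation. -/
noncomputable def sonineEnergy (l : ℝ) (y y₁ : ℝ → ℝ) (x : ℝ) : ℝ := y x ^ 2 + (1 - x ^ 2) * (y₁ x ^ 2 / l)

/-- The weight `(1 - x)^{α + 1/2} (1 + x)^{β + 1/2}` that balances the Sonine energy. -/
noncomputable def sonineWeight (α β x : ℝ) : ℝ := (1 - x) ^ (α + 1 / 2) * (1 + x) ^ (β + 1 / 2)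

theorem sonineWeight_pos (α β : ℝ) {x : ℝ} (h0 : 0 ≤ x) (h1 : x < 1) :
    0 < sonineWeight α β x :=
  mul_pos (Real.rpow_pos_of_pos (by linarith) _) (Real.rpow_pos_of_pos (by linarith) _)

theorem hasDerivAt_sonineWeight (α β : ℝ) {x : ℝ} (h0 : 0 ≤ x) (h1 : x < 1) :
    HasDerivAt (sonineWeight α β)
      (-sonineWeight α β x * (α - β + (α + β + 1) * x) / (1 - x ^ 2)) x := by
  have hm : (0 : ℝ) < 1 - x := by linarith
  have hp : (0 : ℝ) < 1 + x := by linarith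
  have a := ((hasDerivAt_id x).const_sub 1).rpow_const (p := α + 1 / 2) (Or.inl hm.ne')
  have b := ((hasDerivAt_id x).const_add 1).rpow_const (p := β + 1 / 2) (Or.inl hp.ne')
  refine (a.mul b).congr_deriv ?_
  simp only [id, sonineWeight, Real.rpow_sub_one hm.ne', Real.rpow_sub_one hp.ne']
  have : (1 : ℝ) - x ^ 2 = (1 - x) * (1 + x) := by ring
  rw [this]
  field_simp
  ring

theorem tendsto_sonineWeight {α : ℝ} (hα : -(1 / 2) < α) (β : ℝ) :
    Tendsto (sonineWeight α β) (𝓝 1) (𝓝 0) := by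
  have h : ContinuousAt (sonineWeight α β) 1 := by
    refine ContinuousAt.mul ?_ ?_
    · exact ContinuousAt.rpow_const (by fun_prop) (Or.inr (by linarith))
    · exact ContinuousAt.rpow_const (by fun_prop) (Or.inl (by norm_num))
  have h1 : sonineWeight α β 1 = 0 := by
    have : α + 1 / 2 ≠ 0 := by linarith
    simp only [sonineWeight, sub_self, Real.zero_rpow this, zero_mul]
  simpa only [ContinuousAt, h1] using h

namespace IsJacobiSolution

variable {α β l : ℝ} {y y₁ y₂ : ℝ → ℝ}

theorem hasDerivAt_sonineEnergy (h : IsJacobiSolution α β l y y₁ y₂) (hl : 0 < l) {x : ℝ}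
    (h0 : 0 ≤ x) (h1 : x < 1) :
    HasDerivAt (sonineEnergy l y y₁)
      (2 * (y₁ x ^ 2 / l) * (α - β + (α + β + 1) * x)) x := by
  have a := ((h.hasDerivAt x).pow 2).add
    ((((hasDerivAt_id x).pow 2).const_sub 1).mul (((h.hasDerivAt_deriv x).pow 2).div_const l))
  refine a.congr_deriv ?_
  have e := h.ode x h0 h1
  simp only [id, Pi.pow_apply]
  field_simp
  push_cast
  linear_combination 2 * y₁ x * e

theorem sonineEnergy_le (h : IsJacobiSolution α β l y y₁ y₂) (hl : 0 < l)
    (hα : -(1 / 2) < α) {x : ℝ} (h0 : 0 ≤ x) (h1 : x ≤ 1) :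
    sonineEnergy l y y₁ x ≤ Real.exp (2 * |α - β|) := by
  set C := 2 * |α - β| with hC
  have hy : Continuous y := continuous_iff_continuousAt.2 fun x => (h.hasDerivAt x).continuousAt
  have hy₁ : Continuous y₁ :=
    continuous_iff_continuousAt.2 fun x => (h.hasDerivAt_deriv x).continuousAt
  have hd : ∀ x, 0 ≤ x → x < 1 →
      HasDerivAt (fun x => Real.exp (C * x) * sonineEnergy l y y₁ x)
        (Real.exp (C * x) * (C * 1) * sonineEnergy l y y₁ x +
          Real.exp (C * x) * (2 * (y₁ x ^ 2 / l) * (α - β + (α + β + 1) * x))) x :=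
    fun x h0 h1 =>
      (((hasDerivAt_id x).const_mul C).exp).mul (h.hasDerivAt_sonineEnergy hl h0 h1)
  have hmono : MonotoneOn (fun x => Real.exp (C * x) * sonineEnergy l y y₁ x) (Icc 0 1) := by
    refine monotoneOn_of_deriv_nonneg (convex_Icc 0 1) ?_ ?_ ?_
    · unfold sonineEnergy
      fun_prop
    · intro x hx
      rw [interior_Icc] at hx
      exact (hd x hx.1.le hx.2).differentiableAt.differentiableWithinAt
    · intro x hx
      rw [interior_Icc] at hx
      obtain ⟨h0, h1⟩ := hx
      rw [(hd x h0.le h1).deriv, mul_assoc, ← mul_add]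
      refine mul_nonneg (Real.exp_pos _).le ?_
      have ha : 0 ≤ y₁ x ^ 2 / l := by positivity
      have hab : 0 ≤ |α - β| := abs_nonneg _
      have hn : -|α - β| ≤ α - β := neg_abs_le _
      have hB : 0 ≤ α - β + (α + β + 1) * x + |α - β| * (1 - x ^ 2) := by
        nlinarith [mul_nonneg hab (mul_nonneg h0.le (sub_nonneg.2 h1.le)),
          mul_nonneg (sub_nonneg.2 h1.le) (sub_nonneg.2 hn),
          mul_pos h0 (by linarith : 0 < 2 * α + 1)]
      have := mul_nonneg ha hB
      have := mul_nonneg hab (sq_nonneg (y x))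
      simp only [sonineEnergy, hC]
      nlinarith
  have hE : 0 ≤ sonineEnergy l y y₁ x := by
    have : 0 ≤ 1 - x ^ 2 := by nlinarith
    unfold sonineEnergy
    positivity
  have hle := hmono ⟨h0, h1⟩ (right_mem_Icc.2 zero_le_one) h1
  have hone : sonineEnergy l y y₁ 1 = 1 := by simp [sonineEnergy, h.map_one]
  simp only [hone, mul_one] at hle
  have hexp : 1 ≤ Real.exp (C * x) := Real.one_le_exp (by positivity)
  nlinarith

theorem abs_mul_deriv_le (h : IsJacobiSolution α β l y y₁ y₂) (hl : 0 < l)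
    (hα : -(1 / 2) < α) {x : ℝ} (h0 : 0 ≤ x) (h1 : x < 1) :
    |y x * y₁ x / l| ≤ Real.exp (2 * |α - β|) / (1 - x ^ 2) / √l := by
  have hs : 0 < √l := Real.sqrt_pos.2 hl
  have hx : 0 < 1 - x ^ 2 := by nlinarith
  have hE := h.sonineEnergy_le hl hα h0 h1.le
  have hls : l = √l ^ 2 := (Real.sq_sqrt hl.le).symm
  have key : |y x * y₁ x / l| * √l ≤ y x ^ 2 + y₁ x ^ 2 / l := by
    have e : |y x * y₁ x / l| * √l = |y x| * (|y₁ x| / √l) := by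
      rw [abs_div, abs_mul, abs_of_pos hl]
      nth_rewrite 1 [hls]
      field_simp
    have e2 : y₁ x ^ 2 / l = (|y₁ x| / √l) ^ 2 := by
      rw [div_pow, sq_abs, ← hls]
    rw [e, e2, ← sq_abs (y x)]
    nlinarith [sq_nonneg (|y x| - |y₁ x| / √l), sq_nonneg (|y x|), sq_nonneg (|y₁ x| / √l)]
  rw [le_div_iff₀ hs, le_div_iff₀ hx]
  refine le_trans ?_ hE
  have : (1 - x ^ 2) * y x ^ 2 ≤ y x ^ 2 := by nlinarith [sq_nonneg (x * y x)]
  have := mul_le_mul_of_nonneg_right key hx.le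
  unfold sonineEnergy
  linarith

theorem hasDerivAt_correctedEnergy (h : IsJacobiSolution α β l y y₁ y₂) (hl : 0 < l) {x : ℝ}
    (h0 : 0 ≤ x) (h1 : x < 1) :
    HasDerivAt (fun x => sonineWeight α β x * sonineEnergy l y y₁ x -
        sonineWeight α β x * (α - β + (α + β + 1) * x) * (y x * y₁ x / l))
      (sonineWeight α β x * (-(α - β + (α + β + 1) * x) * x / (1 - x ^ 2) - (α + β + 1)) *
        (y x * y₁ x / l)) x := by
  have hx : 1 - x ^ 2 ≠ 0 := by nlinarith
  have w := hasDerivAt_sonineWeight α β h0 h1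
  have b : HasDerivAt (fun x => α - β + (α + β + 1) * x) ((α + β + 1) * 1) x :=
    ((hasDerivAt_id x).const_mul (α + β + 1)).const_add (α - β)
  have a := (w.mul (h.hasDerivAt_sonineEnergy hl h0 h1)).sub
    ((w.mul b).mul (((h.hasDerivAt x).mul (h.hasDerivAt_deriv x)).div_const l))
  refine a.congr_deriv ?_
  have e := h.ode x h0 h1
  have e' : y₂ x = (-(β - α - (α + β + 2) * x) * y₁ x - l * y x) / (1 - x ^ 2) := by
    rw [eq_div_iff hx]
    linear_combination e
  simp only [Pi.mul_apply, sonineEnergy, e']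
  field_simp
  ring

end IsJacobiSolution

theorem exists_weighted_sonineEnergy_le {α : ℝ} (hα : -(1 / 2) < α) (β : ℝ) {x₀ x₁ : ℝ}
    (h0 : 0 ≤ x₀) (h01 : x₀ ≤ x₁) (h1 : x₁ < 1) :
    ∃ D : ℝ, ∀ (l : ℝ) (y y₁ y₂ : ℝ → ℝ), 0 < l → IsJacobiSolution α β l y y₁ y₂ →
      sonineWeight α β x₀ * sonineEnergy l y y₁ x₀ ≤
        sonineWeight α β x₁ * Real.exp (2 * |α - β|) + D / √l := by
  have hw : ContinuousOn (sonineWeight α β) (Icc x₀ x₁) := fun x hx =>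
    (hasDerivAt_sonineWeight α β (h0.trans hx.1)
      (hx.2.trans_lt h1)).continuousAt.continuousWithinAt
  have hne : ∀ x ∈ Icc x₀ x₁, 1 - x ^ 2 ≠ 0 := fun x hx => by
    nlinarith [hx.1, hx.2]
  obtain ⟨A, hA⟩ := isCompact_Icc.exists_bound_of_continuousOn (s := Icc x₀ x₁)
    (f := fun x => sonineWeight α β x * (α - β + (α + β + 1) * x) *
      (Real.exp (2 * |α - β|) / (1 - x ^ 2)))
    ((hw.mul (by fun_prop)).mul (continuousOn_const.div (by fun_prop) hne))
  obtain ⟨G, hG⟩ := isCompact_Icc.exists_bound_of_continuousOn (s := Icc x₀ x₁)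
    (f := fun x => sonineWeight α β x *
      (-(α - β + (α + β + 1) * x) * x / (1 - x ^ 2) - (α + β + 1)) *
        (Real.exp (2 * |α - β|) / (1 - x ^ 2)))
    ((hw.mul ((ContinuousOn.div (by fun_prop) (by fun_prop) hne).sub
      continuousOn_const)).mul (continuousOn_const.div (by fun_prop) hne))
  refine ⟨2 * A + G * (x₁ - x₀), fun l y y₁ y₂ hl h => ?_⟩
  have hs : 0 < √l := Real.sqrt_pos.2 hl
  have hbound : ∀ (c B : ℝ) (x : ℝ), x ∈ Icc x₀ x₁ →
      ‖c * (Real.exp (2 * |α - β|) / (1 - x ^ 2))‖ ≤ B → ‖c * (y x * y₁ x / l)‖ ≤ B / √l := by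
    intro c B x hx hB
    have hp : 0 < 1 - x ^ 2 := by nlinarith [hx.1, hx.2]
    have hq := h.abs_mul_deriv_le hl hα (h0.trans hx.1) (hx.2.trans_lt h1)
    rw [norm_mul, Real.norm_eq_abs (_ / _), abs_of_pos (by positivity)] at hB
    rw [norm_mul, Real.norm_eq_abs (_ / _)]
    refine (mul_le_mul_of_nonneg_left hq (norm_nonneg c)).trans ?_
    rw [← mul_div_assoc]
    gcongr
  have hmv := (convex_Icc x₀ x₁).norm_image_sub_le_of_norm_hasDerivWithin_le
    (fun x hx => (h.hasDerivAt_correctedEnergy hl (h0.trans hx.1)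
      (hx.2.trans_lt h1)).hasDerivWithinAt)
    (fun x hx => hbound _ _ x hx (hG x hx)) (left_mem_Icc.2 h01) (right_mem_Icc.2 h01)
  have b0 := abs_le.1 (hbound _ _ x₀ (left_mem_Icc.2 h01) (hA x₀ (left_mem_Icc.2 h01)))
  have b1 := abs_le.1 (hbound _ _ x₁ (right_mem_Icc.2 h01) (hA x₁ (right_mem_Icc.2 h01)))
  rw [Real.norm_eq_abs, Real.norm_eq_abs, abs_of_nonneg (sub_nonneg.2 h01)] at hmv
  have hmv' := (abs_le.1 hmv).1
  have hE := mul_le_mul_of_nonneg_left (h.sonineEnergy_le hl hα (h0.trans h01) h1.le)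
    (sonineWeight_pos α β (h0.trans h01) h1).le
  have : (2 * A + G * (x₁ - x₀)) / √l = 2 * (A / √l) + G / √l * (x₁ - x₀) := by ring
  rw [this]
  linarith [b0.1, b0.2, b1.1, b1.2]

theorem tendsto_of_isJacobiSolution {α : ℝ} (hα : -(1 / 2) < α) (β : ℝ) {l : ℕ → ℝ}
    {y y₁ y₂ : ℕ → ℝ → ℝ} (hl : Tendsto l atTop atTop)
    (h : ∀ᶠ k in atTop, IsJacobiSolution α β (l k) (y k) (y₁ k) (y₂ k)) {x : ℝ}
    (h0 : 0 ≤ x) (h1 : x < 1) : Tendsto (fun k => y k x) atTop (𝓝 0) := by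
  have hw := sonineWeight_pos α β h0 h1
  suffices hE : Tendsto (fun k => y k x ^ 2) atTop (𝓝 0) by
    have := hE.sqrt
    simp only [Real.sqrt_sq_eq_abs, Real.sqrt_zero] at this
    exact (tendsto_zero_iff_abs_tendsto_zero _).2 this
  rw [Metric.tendsto_atTop']
  intro ε hε
  have hm : Tendsto (fun t => sonineWeight α β t * Real.exp (2 * |α - β|)) (𝓝[<] 1) (𝓝 0) := by
    simpa using ((tendsto_sonineWeight hα β).mul_const _).mono_left nhdsWithin_le_nhds
  have hpos : 0 < sonineWeight α β x * ε / 2 := by positivity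
  obtain ⟨x₁, hx₁, hxx₁, hlt⟩ := ((hm.eventually_lt_const hpos).and
    (Ioo_mem_nhdsLT h1)).exists
  obtain ⟨D, hD⟩ := exists_weighted_sonineEnergy_le hα β h0 hxx₁.le hlt
  have hs : Tendsto (fun k => D / √(l k)) atTop (𝓝 0) :=
    (Real.tendsto_sqrt_atTop.comp hl).const_div_atTop D
  obtain ⟨N, hN⟩ := eventually_atTop.1 ((hs.eventually_lt_const hpos).and
    (h.and (hl.eventually_gt_atTop 0)))
  refine ⟨N, fun k hk => ?_⟩
  obtain ⟨hk1, hk2, hk3⟩ := hN k hk.le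
  have hb := hD _ _ _ _ hk3 hk2
  have hx : 0 ≤ (1 - x ^ 2) * (y₁ k x ^ 2 / l k) :=
    mul_nonneg (by nlinarith) (by positivity)
  rw [Real.dist_eq, sub_zero, abs_of_nonneg (sq_nonneg _)]
  have : sonineWeight α β x * sonineEnergy (l k) (y k) (y₁ k) x < sonineWeight α β x * ε := by
    linarith
  have := lt_of_mul_lt_mul_left this hw.le
  unfold sonineEnergy at this
  linarith

/-- The coefficients of the Jacobi polynomial in powers of `(x - 1) / 2` and `(x + 1) / 2`. -/
noncomputable def jacobiCoeff (α β : ℝ) (k s : ℕ) : ℝ :=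
  genBinom ((k : ℝ) + α) (k - s) * genBinom ((k : ℝ) + β) s

theorem jacobiCoeff_succ {α β : ℝ} (hα : -1 < α) (hβ : -1 < β) {k s : ℕ} (hs : s < k) :
    jacobiCoeff α β k (s + 1) * ((s + 1) * (s + 1 + α)) =
      jacobiCoeff α β k s * ((k - s : ℝ) * (k - s + β)) := by
  obtain ⟨t, rfl⟩ : ∃ t, k = s + (t + 1) := ⟨k - s - 1, by omega⟩
  have hs0 : (0 : ℝ) ≤ s := s.cast_nonneg
  have ht0 : (0 : ℝ) ≤ t := t.cast_nonneg
  have e1 : s + (t + 1) - (s + 1) = t := by omega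
  have e2 : s + (t + 1) - s = t + 1 := by omega
  simp only [jacobiCoeff, genBinom, e1, e2]
  push_cast
  have a1 : (s : ℝ) + (t + 1) + α - t + 1 = (s + 1 + α) + 1 := by ring
  have a2 : (s : ℝ) + (t + 1) + α - (t + 1) + 1 = s + 1 + α := by ring
  have a3 : (s : ℝ) + (t + 1) + β - (s + 1) + 1 = t + 1 + β := by ring
  have a4 : (s : ℝ) + (t + 1) + β - s + 1 = (t + 1 + β) + 1 := by ring
  rw [a1, a2, a3, a4, Real.Gamma_add_one (s := s + 1 + α) (by linarith),
    Real.Gamma_add_one (s := t + 1 + β) (by linarith),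
    Real.Gamma_add_one (s := (s : ℝ) + 1) (by linarith),
    Real.Gamma_add_one (s := (t : ℝ) + 1) (by linarith)]
  have g1 := (Real.Gamma_pos_of_pos (by linarith : (0 : ℝ) < s + 1 + α)).ne'
  have g2 := (Real.Gamma_pos_of_pos (by linarith : (0 : ℝ) < t + 1 + β)).ne'
  have g3 := (Real.Gamma_pos_of_pos (by linarith : (0 : ℝ) < s + 1)).ne'
  have g4 := (Real.Gamma_pos_of_pos (by linarith : (0 : ℝ) < t + 1)).ne'
  have n1 : (s : ℝ) + 1 + α ≠ 0 := by linarith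
  have n2 : (t : ℝ) + 1 + β ≠ 0 := by linarith
  have n3 : (s : ℝ) + 1 ≠ 0 := by linarith
  have n4 : (t : ℝ) + 1 ≠ 0 := by linarith
  field_simp
  ring

theorem jacobiP_one_ne_zero {α β : ℝ} (hα : -1 < α) (hβ : -1 < β) (k : ℕ) :
    jacobiP α β k 1 ≠ 0 := by
  have hk : (0 : ℝ) ≤ k := k.cast_nonneg
  have h : jacobiP α β k 1 = genBinom (k + α) k * genBinom (k + β) 0 := by
    unfold jacobiP
    rw [Finset.sum_eq_single 0]
    · norm_num
    · intro s _ hs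
      simp [hs]
    · simp
  rw [h]
  unfold genBinom
  have g1 := Real.Gamma_pos_of_pos (by linarith : 0 < k + α + 1)
  have g2 := Real.Gamma_pos_of_pos (by linarith : (0 : ℝ) < k + 1)
  have g3 := Real.Gamma_pos_of_pos (by linarith : 0 < k + α - k + 1)
  have g4 := Real.Gamma_pos_of_pos (by linarith : 0 < k + β + 1)
  have g5 := Real.Gamma_pos_of_pos (by simp : 0 < ((0 : ℕ) : ℝ) + 1)
  have g6 := Real.Gamma_pos_of_pos (by push_cast; linarith : 0 < k + β - ((0 : ℕ) : ℝ) + 1)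
  positivity

theorem contDiff_jacobiP (α β : ℝ) (k : ℕ) : ContDiff ℝ 2 (jacobiP α β k) := by
  unfold jacobiP
  fun_prop

theorem contDiff_jacobiR (α β : ℝ) (k : ℕ) : ContDiff ℝ 2 (jacobiR α β k) :=
  (contDiff_jacobiP α β k).div_const _

theorem hasDerivAt_half_pow_mul_half_pow (s t : ℕ) {x : ℝ} (h0 : -1 < x) (h1 : x < 1) :
    HasDerivAt (fun x : ℝ => ((x - 1) / 2) ^ s * ((x + 1) / 2) ^ t)
      (((x - 1) / 2) ^ s * ((x + 1) / 2) ^ t * (s / (x - 1) + t / (x + 1))) x := by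
  have hu : x - 1 ≠ 0 := by linarith
  have hv : x + 1 ≠ 0 := by linarith
  have pow_pred : ∀ (n : ℕ) (z : ℝ), z ≠ 0 → n * z ^ (n - 1) = z ^ n * (n / z) := by
    intro n z hz
    cases n with
    | zero => simp
    | succ n => rw [Nat.add_sub_cancel, pow_succ]; field_simp
  have a := ((((hasDerivAt_id x).sub_const 1).div_const 2).pow s).mul
    ((((hasDerivAt_id x).add_const 1).div_const 2).pow t)
  refine a.congr_deriv ?_
  simp only [id, Pi.pow_apply]
  rw [pow_pred s _ (by positivity), pow_pred t _ (by positivity)]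
  field_simp

theorem hasDerivAt_jacobiP (α β : ℝ) (k : ℕ) {x : ℝ} (h0 : -1 < x) (h1 : x < 1) :
    HasDerivAt (jacobiP α β k) (∑ s ∈ Finset.range (k + 1), jacobiCoeff α β k s *
      (((x - 1) / 2) ^ s * ((x + 1) / 2) ^ (k - s) *
        (s / (x - 1) + (k - s : ℕ) / (x + 1)))) x := by
  have e : jacobiP α β k = fun x => ∑ s ∈ Finset.range (k + 1),
      jacobiCoeff α β k s * (((x - 1) / 2) ^ s * ((x + 1) / 2) ^ (k - s)) := by
    funext x
    simp only [jacobiP, jacobiCoeff, mul_assoc]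
  rw [e]
  exact HasDerivAt.fun_sum fun s _ =>
    (hasDerivAt_half_pow_mul_half_pow s (k - s) h0 h1).const_mul _

theorem deriv_deriv_jacobiP (α β : ℝ) (k : ℕ) {x : ℝ} (h0 : -1 < x) (h1 : x < 1) :
    deriv (deriv (jacobiP α β k)) x = ∑ s ∈ Finset.range (k + 1), jacobiCoeff α β k s *
      (((x - 1) / 2) ^ s * ((x + 1) / 2) ^ (k - s) *
        ((s / (x - 1) + (k - s : ℕ) / (x + 1)) ^ 2 -
          (s / (x - 1) ^ 2 + (k - s : ℕ) / (x + 1) ^ 2))) := by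
  have hu : x - 1 ≠ 0 := by linarith
  have hv : x + 1 ≠ 0 := by linarith
  have hev : deriv (jacobiP α β k) =ᶠ[𝓝 x] fun x => ∑ s ∈ Finset.range (k + 1),
      jacobiCoeff α β k s * (((x - 1) / 2) ^ s * ((x + 1) / 2) ^ (k - s) *
        (s / (x - 1) + (k - s : ℕ) / (x + 1))) := by
    filter_upwards [Ioo_mem_nhds h0 h1] with z hz
    exact (hasDerivAt_jacobiP α β k hz.1 hz.2).deriv
  rw [hev.deriv_eq]
  refine (HasDerivAt.fun_sum fun s _ => ?_).deriv
  refine HasDerivAt.const_mul _ ?_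
  have a := ((hasDerivAt_const x (s : ℝ)).div ((hasDerivAt_id x).sub_const 1) hu).add
    ((hasDerivAt_const x ((k - s : ℕ) : ℝ)).div ((hasDerivAt_id x).add_const 1) hv)
  refine ((hasDerivAt_half_pow_mul_half_pow s (k - s) h0 h1).mul a).congr_deriv ?_
  simp only [id, Pi.add_apply, Pi.div_apply]
  ring

theorem jacobiP_ode {α β : ℝ} (hα : -1 < α) (hβ : -1 < β) (k : ℕ) {x : ℝ}
    (h0 : -1 < x) (h1 : x < 1) :
    (1 - x ^ 2) * deriv (deriv (jacobiP α β k)) x +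
      (β - α - (α + β + 2) * x) * deriv (jacobiP α β k) x +
      k * (k + α + β + 1) * jacobiP α β k x = 0 := by
  have hu : x - 1 ≠ 0 := by linarith
  have hv : x + 1 ≠ 0 := by linarith
  rw [deriv_deriv_jacobiP α β k h0 h1, (hasDerivAt_jacobiP α β k h0 h1).deriv]
  let d : ℕ → ℝ := fun s => if s ≤ k then jacobiCoeff α β k s * (s * (s + α)) *
    (((x - 1) / 2) ^ s * ((x + 1) / 2) ^ (k - s)) * (1 - (x + 1) / (x - 1)) else 0
  have hsum : ∑ s ∈ Finset.range (k + 1), (d (s + 1) - d s) = 0 := by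
    rw [Finset.sum_range_sub]
    simp [d]
  have hP : jacobiP α β k x = ∑ s ∈ Finset.range (k + 1),
      jacobiCoeff α β k s * (((x - 1) / 2) ^ s * ((x + 1) / 2) ^ (k - s)) := by
    simp only [jacobiP, jacobiCoeff, mul_assoc]
  rw [hP, Finset.mul_sum, Finset.mul_sum, Finset.mul_sum, ← Finset.sum_add_distrib,
    ← Finset.sum_add_distrib, ← neg_eq_zero, ← Finset.sum_neg_distrib, ← hsum]
  refine Finset.sum_congr rfl fun s hs => ?_
  have hsk : s ≤ k := by simpa [Nat.lt_succ_iff] using hs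
  have hd : d (s + 1) = jacobiCoeff α β k s * ((k - s : ℝ) * (k - s + β)) *
      (((x - 1) / 2) ^ s * ((x + 1) / 2) ^ (k - s)) * ((x - 1) / (x + 1) - 1) := by
    rcases hsk.eq_or_lt with rfl | hlt
    · simp [d]
    · obtain ⟨t, ht⟩ : ∃ t, k - s = t + 1 := ⟨k - s - 1, by omega⟩
      have ht' : k - (s + 1) = t := by omega
      simp only [d, if_pos (Nat.succ_le_of_lt hlt), ← jacobiCoeff_succ hα hβ hlt, ht, ht']
      push_cast
      field_simp
      ring
  rw [hd]
  simp only [d, if_pos hsk, Nat.cast_sub hsk]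
  have : (1 : ℝ) - x ^ 2 = -(x - 1) * (x + 1) := by ring
  rw [this]
  field_simp
  ring

theorem isJacobiSolution_jacobiR {α β : ℝ} (hα : -1 < α) (hβ : -1 < β) (k : ℕ) :
    IsJacobiSolution α β (k * (k + α + β + 1)) (jacobiR α β k) (deriv (jacobiR α β k))
      (deriv (deriv (jacobiR α β k))) where
  hasDerivAt x := ((contDiff_jacobiR α β k).differentiable (by norm_num) x).hasDerivAt
  hasDerivAt_deriv x :=
    ((contDiff_jacobiR α β k).differentiable_deriv_two x).hasDerivAt
  ode x h0 h1 := by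
    have e : jacobiR α β k = fun x => jacobiP α β k x / jacobiP α β k 1 := rfl
    have e1 : deriv (jacobiR α β k) = fun x => deriv (jacobiP α β k) x / jacobiP α β k 1 := by
      funext x
      rw [e, deriv_div_const]
    rw [e1, deriv_div_const, e]
    linear_combination (jacobiP_ode hα hβ k (by linarith) h1) / jacobiP α β k 1
  map_one := div_self (jacobiP_one_ne_zero hα hβ k)

theorem tendsto_jacobi_eigenvalue (α β : ℝ) :
    Tendsto (fun k : ℕ => (k : ℝ) * (k + α + β + 1)) atTop atTop := by
  refine tendsto_natCast_atTop_atTop.atTop_mul_atTop₀ ?_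
  simpa only [add_assoc] using
    tendsto_atTop_add_const_right atTop (α + (β + 1)) tendsto_natCast_atTop_atTop

/-- For `α > -1/2`, `β > -1` and `f ∈ L_{(α,β)}`, the part of the `k`-th
Fourier–Jacobi coefficient coming from `[0, π/2]` tends to `0` as `k → ∞`. -/
theorem jacobi_coeff_first_half_tendsto_zero (α β : ℝ) (hα : -(1/2) < α) (hβ : -1 < β)
    (f : ℝ → ℝ) (hf : MemJacobiL α β f) :
    Tendsto (fun k : ℕ =>
        ∫ θ in Ioc (0 : ℝ) (Real.pi / 2),
          f θ * jacobiR α β k (Real.cos θ) * jacobiWeight α β θ)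
      atTop (nhds 0) := by
  have hα' : -1 < α := by linarith
  have hl := tendsto_jacobi_eigenvalue α β
  have hint : Integrable (fun θ => f θ * jacobiWeight α β θ)
      (volume.restrict (Ioc 0 (Real.pi / 2))) :=
    hf.mono_set (Ioc_subset_Ioc_right (by linarith [Real.pi_pos]))
  have hcos : ∀ θ ∈ Ioc 0 (Real.pi / 2), 0 ≤ Real.cos θ ∧ Real.cos θ < 1 := fun θ hθ =>
    ⟨Real.cos_nonneg_of_mem_Icc ⟨by linarith [hθ.1, Real.pi_pos], hθ.2⟩,
      by simpa using Real.cos_lt_cos_of_nonneg_of_le_pi_div_two le_rfl hθ.2 hθ.1⟩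
  simp only [mul_right_comm _ (jacobiR _ _ _ _)]
  suffices h : Tendsto (fun k : ℕ => ∫ θ in Ioc (0 : ℝ) (Real.pi / 2),
      f θ * jacobiWeight α β θ * jacobiR α β k (Real.cos θ)) atTop
      (𝓝 (∫ _ in Ioc (0 : ℝ) (Real.pi / 2), (0 : ℝ))) by
    simpa only [integral_zero] using h
  refine tendsto_integral_filter_of_dominated_convergence
    (fun θ => ‖f θ * jacobiWeight α β θ‖ * √(Real.exp (2 * |α - β|))) ?_ ?_
    (hint.norm.mul_const _) ?_
  · exact Eventually.of_forall fun k => hint.aestronglyMeasurable.mul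
      ((contDiff_jacobiR α β k).continuous.comp Real.continuous_cos).aestronglyMeasurable
  · filter_upwards [hl.eventually_gt_atTop 0] with k hk
    filter_upwards [ae_restrict_mem measurableSet_Ioc] with θ hθ
    obtain ⟨c0, c1⟩ := hcos θ hθ
    rw [norm_mul]
    refine mul_le_mul_of_nonneg_left (Real.abs_le_sqrt ?_) (norm_nonneg _)
    refine le_trans ?_ ((isJacobiSolution_jacobiR hα' hβ k).sonineEnergy_le hk hα c0 c1.le)
    exact le_add_of_nonneg_right (mul_nonneg (by nlinarith) (by positivity))
  · filter_upwards [ae_restrict_mem measurableSet_Ioc] with θ hθ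
    obtain ⟨c0, c1⟩ := hcos θ hθ
    simpa using (tendsto_of_isJacobiSolution hα β hl
      (Eventually.of_forall fun k => isJacobiSolution_jacobiR hα' hβ k) c0 c1).const_mul
      (f θ * jacobiWeight α β θ)
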